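/- Let k be a positive integer and let G be a finite simple graph on n ≥ 2 vertices with maximum degree Δ ≥ k and minimum degree δ ≥ 1. Then F_k(G) ≤ (Δ - k + 1)·n / (Δ - k + 1 + min{δ, k}). -/

import Mathlib

open Finset SimpleGraph

/-- One round of the `k`-forcing color change rule: to the currently colored set `C` we add
every vertex `w` having a colored neighbor `v` with at most `k` non-colored neighbors. -/
def kForceStep {V : Type*} [Fintype V] [DecidableEq V] (G : SimpleGraph V)
    [DecidableRel G.Adj] (k : ℕ) (C : Finset V) : Finset V :=
  C ∪ Finset.univ.filter (fun w =>
    ∃ v ∈ C, G.Adj v w ∧ ((G.neighborFinset v) \ C).card ≤ k)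

/-- `S` is a `k`-forcing set: iterating the color change rule starting from `S`
eventually colors all vertices. -/
def IsKForcingSet {V : Type*} [Fintype V] [DecidableEq V] (G : SimpleGraph V)
    [DecidableRel G.Adj] (k : ℕ) (S : Finset V) : Prop :=
  (kForceStep G k)^[Fintype.card V] S = Finset.univ

/-- The `k`-forcing number: the minimum cardinality of a `k`-forcing set. -/
noncomputable def kForcingNumber {V : Type*} [Fintype V] [DecidableEq V] (G : SimpleGraph V)
    [DecidableRel G.Adj] (k : ℕ) : ℕ :=
  sInf {m | ∃ S : Finset V, IsKForcingSet G k S ∧ S.card = m}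

section KForcing

variable {V : Type*} [Fintype V] [DecidableEq V] (G : SimpleGraph V) [DecidableRel G.Adj] (k : ℕ)

theorem subset_kForceStep (C : Finset V) : C ⊆ kForceStep G k C :=
  subset_union_left

theorem kForceStep_mono : Monotone (kForceStep G k) := by
  intro C D hCD
  refine union_subset_union hCD fun w hw => ?_
  simp only [mem_filter, mem_univ, true_and] at hw ⊢
  obtain ⟨v, hv, hvw, hc⟩ := hw
  exact ⟨v, hCD hv, hvw, (card_le_card (sdiff_subset_sdiff Subset.rfl hCD)).trans hc⟩

theorem kForceStep_iterate_fixed_or_le_card (S : Finset V) (i : ℕ) :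
    kForceStep G k ((kForceStep G k)^[i] S) = (kForceStep G k)^[i] S ∨
      i ≤ ((kForceStep G k)^[i] S).card := by
  induction i with
  | zero => exact Or.inr (Nat.zero_le _)
  | succ i ih =>
    rw [Function.iterate_succ_apply']
    rcases ih with ih | ih
    · left
      rw [ih, ih]
    · rcases (subset_kForceStep G k ((kForceStep G k)^[i] S)).eq_or_ssubset with h | h
      · left
        rw [← h, ← h]
      · exact Or.inr (ih.trans_lt (card_lt_card h))

theorem kForceStep_iterate_card (S : Finset V) :
    kForceStep G k ((kForceStep G k)^[Fintype.card V] S) =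
      (kForceStep G k)^[Fintype.card V] S := by
  rcases kForceStep_iterate_fixed_or_le_card G k S (Fintype.card V) with h | h
  · exact h
  · have hu := (card_eq_iff_eq_univ _).1 (le_antisymm (card_le_univ _) h)
    rw [hu]
    exact univ_subset_iff.1 (subset_kForceStep G k univ)

variable {G k}

theorem IsKForcingSet.of_subset_kForceStep {S T : Finset V} (hS : IsKForcingSet G k S)
    (h : S ⊆ kForceStep G k T) : IsKForcingSet G k T := by
  set C := (kForceStep G k)^[Fintype.card V] T with hC
  have hfix : kForceStep G k C = C := kForceStep_iterate_card G k T
  have hTC : T ⊆ C :=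
    Function.id_le_iterate_of_id_le (subset_kForceStep G k) (Fintype.card V) T
  have hSC : S ⊆ C := h.trans ((kForceStep_mono G k hTC).trans hfix.le)
  have hle := (kForceStep_mono G k).iterate (Fintype.card V) hSC
  rw [Function.iterate_fixed hfix, show (kForceStep G k)^[Fintype.card V] S = univ from hS] at hle
  exact univ_subset_iff.1 hle

theorem IsKForcingSet.of_subset_union_neighborFinset {S T : Finset V} (hS : IsKForcingSet G k S)
    {v : V} (hv : v ∈ T) (hc : (G.neighborFinset v \ T).card ≤ k)
    (h : S ⊆ T ∪ G.neighborFinset v) : IsKForcingSet G k T := by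
  refine hS.of_subset_kForceStep (h.trans (union_subset_union_right fun w hw => ?_))
  exact mem_filter.2 ⟨mem_univ w, v, hv, (G.mem_neighborFinset v w).1 hw, hc⟩

variable (G k) in
theorem exists_isKForcingSet_card_eq_kForcingNumber :
    ∃ S : Finset V, IsKForcingSet G k S ∧ S.card = kForcingNumber G k :=
  Nat.sInf_mem (s := {m | ∃ S : Finset V, IsKForcingSet G k S ∧ S.card = m})
    ⟨_, univ, Function.iterate_fixed (univ_subset_iff.1 (subset_kForceStep G k univ)) _, rfl⟩

theorem IsKForcingSet.kForcingNumber_le {S : Finset V} (hS : IsKForcingSet G k S) :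
    kForcingNumber G k ≤ S.card :=
  Nat.sInf_le ⟨S, hS, rfl⟩

theorem min_le_card_neighborFinset_sdiff {S : Finset V} (hS : IsKForcingSet G k S)
    (hmin : S.card = kForcingNumber G k) {v : V} (hv : v ∈ S) :
    min G.minDegree k ≤ (G.neighborFinset v \ S).card := by
  by_contra! hlt
  have hdeg : G.minDegree ≤ (G.neighborFinset v).card := G.minDegree_le_degree v
  have hsplit := card_inter_add_card_sdiff (G.neighborFinset v) S
  obtain ⟨u, hu⟩ : (G.neighborFinset v ∩ S).Nonempty := card_pos.1 (by omega)
  obtain ⟨huv, huS⟩ := mem_inter.1 hu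
  have hne : v ≠ u := ((G.mem_neighborFinset v u).1 huv).ne
  have hT : IsKForcingSet G k (S.erase u) := by
    refine hS.of_subset_union_neighborFinset (mem_erase.2 ⟨hne, hv⟩) ?_ fun x hx => by grind
    have hsub : G.neighborFinset v \ S.erase u ⊆ insert u (G.neighborFinset v \ S) := by grind
    have := (card_le_card hsub).trans (card_insert_le _ _)
    omega
  have := hT.kForcingNumber_le
  have := card_erase_lt_of_mem huS
  omega

theorem card_neighborFinset_inter_add_le {S : Finset V} (hS : IsKForcingSet G k S)
    (hmin : S.card = kForcingNumber G k) (hΔ : k ≤ G.maxDegree) (w : V) :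
    (G.neighborFinset w ∩ S).card + k ≤ G.maxDegree + 1 := by
  by_contra! hlt
  have hdeg : (G.neighborFinset w).card ≤ G.maxDegree := G.degree_le_maxDegree w
  have hsplit := card_inter_add_card_sdiff (G.neighborFinset w) S
  obtain ⟨P, hP, hP2⟩ := exists_subset_card_eq
    (show 2 ≤ (G.neighborFinset w ∩ S).card by omega)
  have hPS : P ⊆ S := hP.trans inter_subset_right
  have hPN : P ⊆ G.neighborFinset w := hP.trans inter_subset_left
  have hT : IsKForcingSet G k (insert w (S \ P)) := by
    refine hS.of_subset_union_neighborFinset (mem_insert_self w _) ?_ fun x hx => by grind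
    have hsub : G.neighborFinset w \ insert w (S \ P) ⊆ P ∪ (G.neighborFinset w \ S) := by grind
    have := (card_le_card hsub).trans (card_union_le _ _)
    omega
  have := hT.kForcingNumber_le
  have := card_insert_le w (S \ P)
  have := card_sdiff_add_card_eq_card hPS
  omega

theorem kForcingNumber_mul_min_le (hΔ : k ≤ G.maxDegree) :
    kForcingNumber G k * min G.minDegree k ≤
      (Fintype.card V - kForcingNumber G k) * (G.maxDegree - k + 1) := by
  obtain ⟨S, hS, hmin⟩ := exists_isKForcingSet_card_eq_kForcingNumber G k
  rw [← hmin, ← card_compl]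
  refine card_mul_le_card_mul G.Adj (fun v hv => ?_) fun w _ => ?_
  · refine (min_le_card_neighborFinset_sdiff hS hmin hv).trans (card_le_card fun x hx => ?_)
    simpa [bipartiteAbove, and_comm] using hx
  · have h := card_neighborFinset_inter_add_le hS hmin hΔ w
    have hsub : bipartiteBelow G.Adj S w ⊆ G.neighborFinset w ∩ S := fun x hx => by
      simpa [bipartiteBelow, and_comm, G.adj_comm w x] using hx
    have := card_le_card hsub
    omega

theorem kForcingNumber_le_card : kForcingNumber G k ≤ Fintype.card V := by
  obtain ⟨S, -, hS⟩ := exists_isKForcingSet_card_eq_kForcingNumber G k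
  exact hS ▸ card_le_univ S

end KForcing

/-- Theorem, main result: If `G` has `n ≥ 2` vertices, maximum degree
`Δ ≥ k` and minimum degree `δ ≥ 1`, then
`F_k(G) ≤ (Δ - k + 1) n / (Δ - k + 1 + min {δ, k})`. -/
theorem kForcingNumber_le_main {V : Type*} [Fintype V] [DecidableEq V]
    (G : SimpleGraph V) [DecidableRel G.Adj] (k : ℕ) (hk : 1 ≤ k)
    (hn : 2 ≤ Fintype.card V) (hΔ : k ≤ G.maxDegree) (hδ : 1 ≤ G.minDegree) :
    (kForcingNumber G k : ℝ) ≤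
      ((G.maxDegree : ℝ) - k + 1) * (Fintype.card V) /
        ((G.maxDegree : ℝ) - k + 1 + (min G.minDegree k : ℕ)) := by
  have h := kForcingNumber_mul_min_le (G := G) hΔ
  have hF := kForcingNumber_le_card (G := G) (k := k)
  have hΔ' : (k : ℝ) ≤ G.maxDegree := by exact_mod_cast hΔ
  have h' : (kForcingNumber G k : ℝ) * (min G.minDegree k : ℕ) ≤
      (Fintype.card V - kForcingNumber G k) * (G.maxDegree - k + 1) := by
    rw [← Nat.cast_sub hF, ← Nat.cast_sub hΔ]
    exact_mod_cast h
  rw [le_div_iff₀ (by linarith [Nat.cast_nonneg (α := ℝ) (min G.minDegree k)])]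
  linarith
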